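/- Let N ≥ 2, s ∈ (0,1), and let Ω ⊂ ℝ^N be a bounded C² domain with 0 ∈ Ω. Let f ∈ C^θ_loc(cl(Ω)∖{0}) for some θ ∈ (0,1) be nonnegative with ∫_Ω f dx = +∞. Then there exists no nonnegative function u ∈ L^∞_loc(ℝ^N∖{0}) ∩ L¹(ℝ^N, dx/(1+|x|^{N+2s})) which is a distributional solution of (−Δ)^s u = f in Ω∖{0} with u = 0 in ℝ^N∖Ω. -/

import Mathlib

open MeasureTheory Filter Set Topology Metric

noncomputable section

/-- Euclidean space `ℝ^N`. -/
abbrev EN (N : ℕ) := EuclideanSpace ℝ (Fin N)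

/-- The normalizing constant `C_{N,s}` of the fractional Laplacian. -/
def CNs (N : ℕ) (s : ℝ) : ℝ :=
  2 ^ (2*s) * Real.pi ^ (-(N:ℝ)/2) * s * Real.Gamma ((N + 2*s)/2) / Real.Gamma (1 - s)

/-- The optimal fractional Hardy constant `μ₀`. -/
def mu0 (N : ℕ) (s : ℝ) : ℝ :=
  -(2 ^ (2*s) * Real.Gamma ((N + 2*s)/4) ^ 2 / Real.Gamma ((N - 2*s)/4) ^ 2)

/-- The function `τ ↦ c_s(τ)`. -/
def csFun (N : ℕ) (s τ : ℝ) : ℝ :=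
  2 ^ (2*s) * Real.Gamma ((N + τ)/2) * Real.Gamma ((2*s - τ)/2) /
    (Real.Gamma (-τ/2) * Real.Gamma ((N - 2*s + τ)/2))

/-- `u` has fractional Laplacian `(-Δ)^s u (x) = L` at `x`, as a principal value. -/
def HasFracLap (N : ℕ) (s : ℝ) (u : EN N → ℝ) (x : EN N) (L : ℝ) : Prop :=
  Tendsto (fun ε : ℝ =>
      CNs N s * ∫ z in {z : EN N | ε ≤ dist x z}, (u x - u z) / dist x z ^ ((N:ℝ) + 2*s))
    (𝓝[>] 0) (𝓝 L)

/-- `v` has weighted fractional Laplacian `(-Δ)^s_{Γ_μ} v (x) = L` at `x`, where the weight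
is `Γ_μ(z) = ‖z‖ ^ τp` with `τp = τ₊(s,μ)`. -/
def HasWFracLap (N : ℕ) (s τp : ℝ) (v : EN N → ℝ) (x : EN N) (L : ℝ) : Prop :=
  Tendsto (fun ε : ℝ =>
      CNs N s * ∫ z in {z : EN N | ε ≤ dist x z},
        (v x - v z) * ‖z‖ ^ τp / dist x z ^ ((N:ℝ) + 2*s))
    (𝓝[>] 0) (𝓝 L)

/-- Membership in `L¹(ℝ^N, dx/(1+|x|^{N+2s}))`. -/
def MemL1w (N : ℕ) (s : ℝ) (u : EN N → ℝ) : Prop :=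
  Integrable (fun x : EN N => u x / (1 + ‖x‖ ^ ((N:ℝ) + 2*s)))

/-- Membership in `L^∞_loc(ℝ^N \ {0})`. -/
def LocBddAway (N : ℕ) (u : EN N → ℝ) : Prop :=
  ∀ K : Set (EN N), IsCompact K → (0:EN N) ∉ K → ∃ C : ℝ, ∀ x ∈ K, |u x| ≤ C

/-- Local `θ`-Hölder continuity on compact subsets of `S`, i.e. `C^θ_loc(S)`. -/
def HolderLocOn (N : ℕ) (θ : ℝ) (f : EN N → ℝ) (S : Set (EN N)) : Prop :=
  ∀ K ⊆ S, IsCompact K → ∃ C : ℝ, ∀ x ∈ K, ∀ y ∈ K, |f x - f y| ≤ C * dist x y ^ θ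

/-- Membership in `L^∞_loc(S)`. -/
def LinfLocOn (N : ℕ) (f : EN N → ℝ) (S : Set (EN N)) : Prop :=
  AEMeasurable f ∧ ∀ K ⊆ S, IsCompact K → ∃ C : ℝ, ∀ x ∈ K, |f x| ≤ C

/-- A bounded `C²` domain: open, connected and bounded, whose boundary is the regular zero
level set of a `C²` defining function. -/
structure IsBoundedC2Domain (N : ℕ) (Ω : Set (EN N)) : Prop where
  isOpen : IsOpen Ω
  isConnected : IsConnected Ω
  isBounded : Bornology.IsBounded Ω
  c2Boundary : ∃ φ : EN N → ℝ, ContDiff ℝ 2 φ ∧ Ω = {x | φ x < 0} ∧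
    ∀ x ∈ frontier Ω, fderiv ℝ φ x ≠ 0

/-- A bounded domain: open, connected and bounded. -/
def IsBoundedDomain (N : ℕ) (Ω : Set (EN N)) : Prop :=
  IsOpen Ω ∧ IsConnected Ω ∧ Bornology.IsBounded Ω

/-- The first standard coordinate vector `e₁ ∈ ℝ^N`. -/
def e1 (N : ℕ) : EN N :=
  (EuclideanSpace.equiv (Fin N) ℝ).symm (fun i => if (i:ℕ) = 0 then 1 else 0)

/-- The surface measure `ω_{N-1}` of the unit sphere in `ℝ^N`. -/
def omegaN (N : ℕ) : ℝ := N * (volume (ball (0 : EN N) 1)).toReal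

/-- The normalization constant `c_{s,0}`. -/
def cs0 (N : ℕ) (s : ℝ) : ℝ :=
  CNs N s * omegaN N * ∫ t in Ioo (0:ℝ) 1, ∫ z in ball (0:EN N) t,
    (‖z‖ ^ (2*s - N) - 1) / ‖e1 N - z‖ ^ ((N:ℝ) + 2*s)

/-- The fundamental solution `Φ_μ`, expressed via the exponent `τ = τ₋(s,μ)`:
`Φ_μ(x) = |x|^τ` for `μ ≠ μ₀` and `Φ_{μ₀}(x) = -|x|^τ ln |x|`. -/
def Phi (N : ℕ) (s μ τ : ℝ) (x : EN N) : ℝ :=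
  if μ = mu0 N s then -(‖x‖ ^ τ * Real.log ‖x‖) else ‖x‖ ^ τ

/-- The integrand appearing in the definition of `c_{s,μ}`. -/
def cIntegrand (N : ℕ) (s μ τm τp : ℝ) (z : EN N) : ℝ :=
  if μ = mu0 N s then ‖z‖ ^ ((2*s - N)/2) * (-Real.log ‖z‖) / ‖e1 N - z‖ ^ ((N:ℝ) + 2*s)
  else (‖z‖ ^ τm - ‖z‖ ^ τp) / ‖e1 N - z‖ ^ ((N:ℝ) + 2*s)

/-- The normalization constant `c_{s,μ}`. -/
def csmu (N : ℕ) (s μ τm τp : ℝ) : ℝ :=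
  CNs N s * omegaN N * ∫ t in Ioo (0:ℝ) 1, ∫ z in ball (0:EN N) t, cIntegrand N s μ τm τp z

/-- The weight `Λ_μ`, expressed via `τp = τ₊(s,μ)`. -/
def Lam (N : ℕ) (s τp : ℝ) (x : EN N) : ℝ :=
  if 2*s - 1 < τp then 1
  else if τp < 2*s - 1 then ‖x‖ ^ (1 - 2*s + τp)
  else 1 + max (-Real.log ‖x‖) 0

/-- The quadratic form `E^s(u,v)`. -/
def Es (N : ℕ) (s : ℝ) (u v : EN N → ℝ) : ℝ :=
  (CNs N s / 2) *
    ∫ p : EN N × EN N, (u p.1 - u p.2) * (v p.1 - v p.2) / dist p.1 p.2 ^ ((N:ℝ) + 2*s)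

/-- The quadratic form `E^s_μ(u,v)`. -/
def Esmu (N : ℕ) (s μ : ℝ) (u v : EN N → ℝ) : ℝ :=
  Es N s u v + μ * ∫ x : EN N, u x * v x / ‖x‖ ^ (2*s)

/-- `E^s_{A,B}(u,u) < ∞`. -/
def FiniteEnergyOn (N : ℕ) (s : ℝ) (u : EN N → ℝ) (A B : Set (EN N)) : Prop :=
  IntegrableOn (fun p : EN N × EN N => (u p.1 - u p.2)^2 / dist p.1 p.2 ^ ((N:ℝ) + 2*s)) (A ×ˢ B)

/-- Membership in `H^s(ℝ^N)`: locally `L²` with finite Gagliardo seminorm. -/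
def MemHs (N : ℕ) (s : ℝ) (u : EN N → ℝ) : Prop :=
  (∀ K : Set (EN N), IsCompact K → IntegrableOn (fun x => (u x)^2) K) ∧
  FiniteEnergyOn N s u univ univ

/-- Membership in `H^s_0(Ω)`. -/
def MemHs0 (N : ℕ) (s : ℝ) (Ω : Set (EN N)) (u : EN N → ℝ) : Prop :=
  MemHs N s u ∧ ∀ᵐ x : EN N, x ∉ Ω → u x = 0

/-- Membership in `W^s(Ω)`. -/
def MemWs (N : ℕ) (s : ℝ) (Ω : Set (EN N)) (u : EN N → ℝ) : Prop :=
  MemL1w N s u ∧ IntegrableOn (fun x => (u x)^2) Ω ∧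
  ∃ Ω' : Set (EN N), IsOpen Ω' ∧ IsConnected Ω' ∧ closure Ω ⊆ Ω' ∧ FiniteEnergyOn N s u Ω Ω'

/-- Membership in `W^s_*(Ω)`. -/
def MemWsStar (N : ℕ) (s : ℝ) (Ω : Set (EN N)) (u : EN N → ℝ) : Prop :=
  MemL1w N s u ∧ ∀ ε : ℝ, 0 < ε → MemWs N s (Ω \ closedBall 0 ε) u

/-- The distributional identity `L^s_μ u = f` in `Ω \ {0}`, tested against `C^∞_c(Ω\{0})`. -/
def DistrEq (N : ℕ) (s μ : ℝ) (Ω : Set (EN N)) (f u : EN N → ℝ) : Prop :=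
  ∀ φ : EN N → ℝ, ContDiff ℝ (⊤ : ℕ∞) φ → HasCompactSupport φ → tsupport φ ⊆ Ω \ {0} →
    ∀ g : EN N → ℝ, (∀ x, HasFracLap N s φ x (g x)) →
      (∫ x, u x * g x) + μ * ∫ x, u x * φ x / ‖x‖ ^ (2*s) = ∫ x in Ω, f x * φ x

/-- A distributional solution of `L^s_μ u = f` in `Ω \ {0}` with `u = 0` in `ℝ^N \ Ω`. -/
def IsDistrSol (N : ℕ) (s μ : ℝ) (Ω : Set (EN N)) (f u : EN N → ℝ) : Prop :=
  LocBddAway N u ∧ MemL1w N s u ∧ (∀ x ∉ Ω, u x = 0) ∧ DistrEq N s μ Ω f u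

open Real in
lemma h_tangent : ∀ a : ℝ, a ≤ 1/2 → ∃ c : ℝ, 0 ≤ c ∧ c ≤ 2 ∧
    ∀ b : ℝ, b ≤ 1/2 → expNegInvGlue a - expNegInvGlue b ≤ c * (a - b) := by
  have hd1 : ∀ x : ℝ, HasDerivAt expNegInvGlue ((x⁻¹)^2 * expNegInvGlue x) x := by
    intro x
    have := expNegInvGlue.hasDerivAt_polynomial_eval_inv_mul 1 x
    simpa using this
  have hd2 : ∀ x : ℝ, HasDerivAt (fun x => (x⁻¹)^2 * expNegInvGlue x)
      ((x⁻¹)^2 * ((x⁻¹)^2 - 2 * x⁻¹) * expNegInvGlue x) x := by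
    intro x
    have := expNegInvGlue.hasDerivAt_polynomial_eval_inv_mul (Polynomial.X^2) x
    simpa [one_add_one_eq_two] using this
  have hconv : ConvexOn ℝ (Iic (1/2:ℝ)) expNegInvGlue := by
    apply convexOn_of_hasDerivWithinAt2_nonneg (convex_Iic _)
      (f' := fun x => (x⁻¹)^2 * expNegInvGlue x)
      (f'' := fun x => (x⁻¹)^2 * ((x⁻¹)^2 - 2 * x⁻¹) * expNegInvGlue x)
    · exact fun x _ => (hd1 x).continuousAt.continuousWithinAt
    · exact fun x _ => (hd1 x).hasDerivWithinAt
    · exact fun x _ => (hd2 x).hasDerivWithinAt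
    · intro x hx
      simp only [interior_Iic, mem_Iio] at hx
      rcases le_or_gt x 0 with h | h
      · simp [expNegInvGlue.zero_of_nonpos h]
      · have h2 : 2 ≤ x⁻¹ := by
          rw [le_inv_comm₀ (by norm_num) h]; linarith
        have := expNegInvGlue.nonneg x
        have h3 : 0 ≤ (x⁻¹)^2 - 2 * x⁻¹ := by nlinarith
        positivity
  intro a ha
  refine ⟨(a⁻¹)^2 * expNegInvGlue a, ?_, ?_, ?_⟩
  · have := expNegInvGlue.nonneg a
    positivity
  · rcases le_or_gt a 0 with h | h
    · simp [expNegInvGlue.zero_of_nonpos h]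
    · have hi : 0 < a⁻¹ := by positivity
      have := Real.quadratic_le_exp_of_nonneg hi.le
      simp only [expNegInvGlue, not_le.2 h, if_false]
      rw [Real.exp_neg, ← div_eq_mul_inv, div_le_iff₀ (Real.exp_pos _)]
      nlinarith
  · intro b hb
    rcases lt_trichotomy a b with h | h | h
    · have := hconv.le_slope_of_hasDerivAt (mem_Iic.2 ha) (mem_Iic.2 hb) h (hd1 a)
      rw [slope_def_field, le_div_iff₀ (by linarith)] at this
      linarith
    · subst h; simp
    · have := hconv.slope_le_of_hasDerivAt (mem_Iic.2 hb) (mem_Iic.2 ha) h (hd1 a)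
      rw [slope_def_field, div_le_iff₀ (by linarith)] at this
      linarith

lemma submean_complex (z w : ℂ) (d : ℝ) (hd : 0 < d) :
    (2 * Real.pi) * Real.log (‖z‖^2 + d) ≤
      ∫ t in (0:ℝ)..(2 * Real.pi), Real.log (‖z + Complex.exp (t * Complex.I) * w‖^2 + d) := by
  set c : ℂ := (starRingEnd ℂ) z * w with hc
  set a : ℝ := ‖z‖^2 + d with ha
  set r : ℝ := ‖w‖^2 with hr
  have hr0 : 0 ≤ r := by positivity
  have ha0 : 0 < a := by positivity
  have hcn : ‖c‖^2 = ‖z‖^2 * r := by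
    rw [hc, norm_mul, RCLike.norm_conj, mul_pow]
  set D : ℝ := Real.sqrt ((a + r)^2 - 4 * ‖c‖^2) with hD
  have hDs : 0 ≤ (a + r)^2 - 4 * ‖c‖^2 := by
    rw [hcn]; nlinarith [sq_nonneg (a - r), mul_nonneg hd.le hr0]
  have hD2 : D^2 = (a + r)^2 - 4 * ‖c‖^2 := Real.sq_sqrt hDs
  have hD0 : 0 ≤ D := Real.sqrt_nonneg _
  have hDar : a - r ≤ D := by
    apply Real.le_sqrt_of_sq_le
    rw [hcn]; nlinarith [mul_nonneg hd.le hr0]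
  set P : ℝ := (a + r + D) / 2 with hP
  have hPa : a ≤ P := by rw [hP]; linarith
  have hP0 : 0 < P := by linarith
  have hPq : P + ‖c‖^2 / P = a + r := by
    field_simp
    rw [hP]; nlinarith
  set p : ℝ := Real.sqrt P with hp
  have hp0 : 0 < p := Real.sqrt_pos.2 hP0
  have hp2 : p^2 = P := Real.sq_sqrt hP0.le
  set q : ℂ := c / p with hq
  have hqn : ‖q‖ = ‖c‖ / p := by
    rw [hq, norm_div, Complex.norm_real, Real.norm_of_nonneg hp0.le]
  have hqp : ‖q‖ < p := by
    rw [hqn, div_lt_iff₀ hp0]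
    have : 2 * ‖c‖ < a + r := by
      apply lt_of_pow_lt_pow_left₀ 2 (by positivity)
      rw [mul_pow, hcn]
      have : 0 < d * r + d * a + (a - r)^2 := by positivity
      nlinarith [sq_nonneg (a - r), mul_pos hd ha0, mul_nonneg hd.le hr0, sq_nonneg (a+r), sq_nonneg (a - d - r), sq_nonneg (‖z‖), mul_nonneg (sq_nonneg ‖z‖) hr0]
    rw [← sq, hp2, hP]; nlinarith
  have hne : ∀ ζ : ℂ, ‖ζ‖ ≤ 1 → (p:ℂ) + q * ζ ≠ 0 := by
    intro ζ hζ h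
    have h1 : (p:ℂ) = - (q * ζ) := eq_neg_of_add_eq_zero_left h
    have h2 : ‖(p:ℂ)‖ = ‖q‖ * ‖ζ‖ := by rw [h1, norm_neg, norm_mul]
    rw [Complex.norm_real, Real.norm_of_nonneg hp0.le] at h2
    nlinarith [norm_nonneg q]
  have key : ∀ t : ℝ, ‖z + Complex.exp (t * Complex.I) * w‖^2 + d
      = ‖(p:ℂ) + q * Complex.exp (t * Complex.I)‖^2 := by
    intro t
    set e := Complex.exp (t * Complex.I) with he
    have hen : ‖e‖ = 1 := Complex.norm_exp_ofReal_mul_I t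
    have hpq : (p:ℂ) * q = c := by
      rw [hq]; field_simp [Complex.ofReal_ne_zero.2 hp0.ne']
    have e1 : ‖z + e * w‖^2 = ‖z‖^2 + r + 2 * (c * e).re := by
      rw [← Complex.normSq_eq_norm_sq, Complex.normSq_add, Complex.normSq_eq_norm_sq,
        Complex.normSq_eq_norm_sq, norm_mul, hen, one_mul]
      have : (z * (starRingEnd ℂ) (e * w)).re = (c * e).re := by
        rw [hc]; simp [Complex.mul_re]; ring
      rw [this]
    have e2 : ‖(p:ℂ) + q * e‖^2 = P + ‖c‖^2 / P + 2 * (c * e).re := by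
      rw [← Complex.normSq_eq_norm_sq, Complex.normSq_add, Complex.normSq_eq_norm_sq,
        Complex.normSq_eq_norm_sq, norm_mul, hen, mul_one, hqn, Complex.norm_real,
        Real.norm_of_nonneg hp0.le, div_pow, hp2]
      have : ((p:ℂ) * (starRingEnd ℂ) (q * e)).re = (c * e).re := by
        rw [← hpq]; simp [Complex.mul_re]; ring
      rw [this]
    rw [e1, e2, hPq, ha]; ring
  have harm : InnerProductSpace.HarmonicOnNhd (fun ζ : ℂ => Real.log ‖(p:ℂ) + q * ζ‖)
      (closedBall 0 |(1:ℝ)|) := by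
    intro ζ hζ
    apply AnalyticAt.harmonicAt_log_norm (by fun_prop)
    apply hne
    simpa using hζ
  have hav := InnerProductSpace.HarmonicOnNhd.circleAverage_eq harm
  rw [Real.circleAverage_def] at hav
  simp only [circleMap, Complex.ofReal_one, one_mul, zero_add, mul_zero, add_zero, Complex.norm_real,
    Real.norm_of_nonneg hp0.le, smul_eq_mul] at hav
  have hI : ∫ t in (0:ℝ)..(2 * Real.pi), Real.log ‖(p:ℂ) + q * Complex.exp (t * Complex.I)‖
      = 2 * Real.pi * Real.log p := by
    rw [← hav, mul_inv_cancel_left₀ (by positivity)]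
  simp_rw [key, Real.log_pow]
  rw [intervalIntegral.integral_const_mul, hI]
  have : Real.log a ≤ Real.log (p^2) := by rw [hp2]; exact Real.log_le_log ha0 hPa
  rw [Real.log_pow] at this
  nlinarith [Real.pi_pos]

def kern (N : ℕ) (s ρ : ℝ) (y : EN N) : ℝ :=
  if ρ ≤ ‖y‖ then (‖y‖ ^ ((N:ℝ) + 2*s))⁻¹ else 0

def qf (N : ℕ) (x : EN N) : ℝ := Real.log (1 + ‖x‖^2)

lemma qf_nonneg (N : ℕ) (x : EN N) : 0 ≤ qf N x :=
  Real.log_nonneg (by nlinarith [sq_nonneg ‖x‖])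

lemma qf_cont (N : ℕ) : Continuous (qf N) := by
  unfold qf
  refine Continuous.log (by fun_prop) (fun x => ?_)
  positivity

lemma kern_nonneg (N : ℕ) (s ρ : ℝ) (y : EN N) : 0 ≤ kern N s ρ y := by
  unfold kern; split_ifs <;> positivity

lemma kern_meas (N : ℕ) (s ρ : ℝ) : Measurable (kern N s ρ) := by
  unfold kern
  refine Measurable.ite (measurableSet_le measurable_const measurable_norm) ?_ measurable_const
  fun_prop

lemma D_int (N : ℕ) (hN : 2 ≤ N) (s : ℝ) (hs : s ∈ Ioo (0:ℝ) 1) :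
    Integrable (fun y : EN N => qf N y * (‖y‖ ^ ((N:ℝ) + 2*s))⁻¹) := by
  have : Nontrivial (EN N) := by
    have : Nonempty (Fin N) := ⟨⟨0, by omega⟩⟩
    infer_instance
  have h1 : ∀ t : ℝ, 0 < t → t ^ (N - 1) * (Real.log (1 + t^2) * (t ^ ((N:ℝ) + 2*s))⁻¹)
      = Real.log (1 + t^2) * t ^ (-1 - 2*s) := by
    intro t ht
    have e : (t ^ (N-1) : ℝ) = t ^ ((N:ℝ) - 1) := by
      rw [← Real.rpow_natCast, Nat.cast_sub (by omega)]; simp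
    rw [e, ← Real.rpow_neg ht.le, mul_left_comm, ← Real.rpow_add ht]
    congr 2; ring
  have := (integrable_fun_norm_addHaar (volume : Measure (EN N))
    (f := fun t : ℝ => Real.log (1 + t^2) * (t ^ ((N:ℝ) + 2*s))⁻¹))
  unfold qf
  rw [this]
  simp only [finrank_euclideanSpace, Fintype.card_fin, smul_eq_mul]
  rw [integrableOn_congr_fun (s := Ioi (0:ℝ)) (fun t ht => h1 t ht) measurableSet_Ioi]
  have hu : Ioi (0:ℝ) = Ioc 0 1 ∪ Ioi 1 := by rw [Ioc_union_Ioi_eq_Ioi (by norm_num)]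
  have hm : ∀ S : Set ℝ, AEStronglyMeasurable
      (fun t : ℝ => Real.log (1 + t^2) * t ^ (-1 - 2*s)) (volume.restrict S) := by
    intro S
    apply Measurable.aestronglyMeasurable
    exact (Real.measurable_log.comp (by fun_prop)).mul (by fun_prop)
  rw [hu]
  refine IntegrableOn.union ?_ ?_
  · have hi : IntegrableOn (fun t : ℝ => t ^ (1 - 2*s)) (Ioc 0 1) := by
      rw [← intervalIntegrable_iff_integrableOn_Ioc_of_le (by norm_num)]
      exact intervalIntegral.intervalIntegrable_rpow' (by linarith [hs.2])
    refine Integrable.mono' hi (hm _) ?_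
    refine (ae_restrict_iff' measurableSet_Ioc).2 (Eventually.of_forall fun t ht => ?_)
    have ht0 : 0 < t := ht.1
    have hl : 0 ≤ Real.log (1 + t^2) := Real.log_nonneg (by nlinarith)
    rw [Real.norm_of_nonneg (by positivity)]
    have : (1 - 2*s) = 2 + (-1 - 2*s) := by ring
    rw [this, Real.rpow_add ht0]
    gcongr
    have := Real.log_le_sub_one_of_pos (show 0 < 1 + t^2 by positivity)
    norm_num
    linarith
  · have hi : IntegrableOn (fun t : ℝ => (2 * 2^s / s) * t ^ (-1 - s)) (Ioi 1) :=
      (integrableOn_Ioi_rpow_of_lt (by linarith [hs.1]) (by norm_num)).const_mul _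
    refine Integrable.mono' hi (hm _) ?_
    refine (ae_restrict_iff' measurableSet_Ioi).2 (Eventually.of_forall fun t ht => ?_)
    have ht1 : 1 < t := ht
    have ht0 : 0 < t := by linarith
    have hl : 0 ≤ Real.log (1 + t^2) := Real.log_nonneg (by nlinarith)
    rw [Real.norm_of_nonneg (by positivity)]
    have : (-1 - s) = s + (-1 - 2*s) := by ring
    rw [this, Real.rpow_add ht0, ← mul_assoc]
    gcongr
    calc Real.log (1 + t^2) ≤ Real.log ((2*t)^2) := Real.log_le_log (by positivity) (by nlinarith)
      _ = 2 * Real.log (2*t) := by rw [Real.log_pow]; norm_num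
      _ ≤ 2 * ((2*t)^s / s) := by
        gcongr; exact Real.log_le_rpow_div (by positivity) hs.1
      _ = _ := by rw [Real.mul_rpow (by norm_num) ht0.le]; ring

lemma kern_int (N : ℕ) (hN : 2 ≤ N) (s : ℝ) (hs : s ∈ Ioo (0:ℝ) 1) (ρ : ℝ) (hρ : 0 < ρ) :
    Integrable (fun y : EN N => (1 + qf N y) * kern N s ρ y) := by
  have hc : 0 < Real.log (1 + ρ^2) := Real.log_pos (by nlinarith)
  refine Integrable.mono' ((D_int N hN s hs).const_mul ((Real.log (1 + ρ^2))⁻¹ + 1))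
    (((measurable_const.add (qf_cont N).measurable).mul (kern_meas N s ρ)).aestronglyMeasurable)
    (Eventually.of_forall fun y => ?_)
  have hq := qf_nonneg N y
  rw [Real.norm_of_nonneg (mul_nonneg (by linarith) (kern_nonneg _ _ _ _))]
  unfold kern
  split_ifs with h
  · rw [← mul_assoc]
    gcongr
    have : Real.log (1 + ρ^2) ≤ qf N y := Real.log_le_log (by positivity) (by gcongr)
    have : 1 ≤ (Real.log (1 + ρ^2))⁻¹ * qf N y := by
      rw [inv_mul_eq_div, le_div_iff₀ hc]; linarith
    linarith
  · rw [mul_zero]; positivity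

lemma kern_mul_int (N : ℕ) (hN : 2 ≤ N) (s : ℝ) (hs : s ∈ Ioo (0:ℝ) 1) (ρ : ℝ) (hρ : 0 < ρ)
    (G : EN N → ℝ) (hG : Continuous G) (C : ℝ) (hC : ∀ y, |G y| ≤ C * (1 + qf N y)) :
    Integrable (fun y : EN N => G y * kern N s ρ y) := by
  refine Integrable.mono' ((kern_int N hN s hs ρ hρ).const_mul C)
    ((hG.measurable.mul (kern_meas N s ρ)).aestronglyMeasurable)
    (Eventually.of_forall fun y => ?_)
  rw [norm_mul, Real.norm_of_nonneg (kern_nonneg _ _ _ _), ← mul_assoc]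
  exact mul_le_mul_of_nonneg_right (hC y) (kern_nonneg _ _ _ _)

lemma kern_norm {N : ℕ} {s ρ : ℝ} {y y' : EN N} (h : ‖y‖ = ‖y'‖) :
    kern N s ρ y = kern N s ρ y' := by
  unfold kern; rw [h]

/-- symmetrization -/
lemma kern_symm (N : ℕ) (s : ℝ) (ρ : ℝ)
    (G : EN N → ℝ) (hG : Integrable (fun y : EN N => G y * kern N s ρ y)) :
    Integrable (fun y => ((G y + G (-y)) / 2) * kern N s ρ y) ∧
    ∫ y, G y * kern N s ρ y = ∫ y, ((G y + G (-y)) / 2) * kern N s ρ y := by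
  have h1 : ∫ y, G (-y) * kern N s ρ y = ∫ y, G y * kern N s ρ y := by
    rw [← integral_neg_eq_self (fun y => G y * kern N s ρ y)]
    simp_rw [kern_norm (norm_neg _)]
  have h2 : Integrable (fun y : EN N => G (-y) * kern N s ρ y) := by
    have := hG.comp_neg
    simp_rw [kern_norm (norm_neg _)] at this
    exact this
  have h3 : ∀ y, ((G y + G (-y)) / 2) * kern N s ρ y
      = (1/2) * (G y * kern N s ρ y + G (-y) * kern N s ρ y) := by intro y; ring
  simp_rw [h3]
  refine ⟨(hG.add h2).const_mul _, ?_⟩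
  rw [integral_const_mul, integral_add hG h2, h1]; ring

lemma qf_add_le (N : ℕ) (x y : EN N) : qf N (x + y) ≤ Real.log 2 + qf N x + qf N y := by
  unfold qf
  rw [← Real.log_mul (by norm_num) (by positivity), ← Real.log_mul (by positivity) (by positivity)]
  apply Real.log_le_log (by positivity)
  have : ‖x + y‖ ≤ ‖x‖ + ‖y‖ := norm_add_le _ _
  have h2 : ‖x + y‖^2 ≤ (‖x‖ + ‖y‖)^2 := by gcongr
  nlinarith [sq_nonneg (‖x‖ - ‖y‖), mul_nonneg (sq_nonneg ‖x‖) (sq_nonneg ‖y‖)]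

lemma qf_second (N : ℕ) (x y : EN N) :
    ((qf N (x + y) - qf N x) + (qf N (x + -y) - qf N x)) / 2 ≤ qf N y := by
  have h : (1 + ‖x + y‖^2) * (1 + ‖x + -y‖^2) ≤ ((1 + ‖x‖^2) * (1 + ‖y‖^2))^2 := by
    have hp : ‖x + y‖^2 + ‖x + -y‖^2 = 2 * (‖x‖^2 + ‖y‖^2) := by
      have := parallelogram_law_with_norm ℝ x y
      rw [← sub_eq_add_neg]; nlinarith
    have h1 : (1 + ‖x + y‖^2) * (1 + ‖x + -y‖^2) ≤ (1 + ‖x‖^2 + ‖y‖^2)^2 := by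
      nlinarith [sq_nonneg (‖x + y‖^2 - ‖x + -y‖^2)]
    refine h1.trans ?_
    gcongr
    nlinarith [mul_nonneg (sq_nonneg ‖x‖) (sq_nonneg ‖y‖)]
  have h2 := Real.log_le_log (by positivity) h
  rw [Real.log_mul (by positivity) (by positivity), Real.log_pow,
    Real.log_mul (by positivity) (by positivity)] at h2
  unfold qf
  push_cast at h2
  linarith

lemma q_bound (N : ℕ) (hN : 2 ≤ N) (s : ℝ) (hs : s ∈ Ioo (0:ℝ) 1) (ρ : ℝ) (hρ : 0 < ρ) (x : EN N) :
    Integrable (fun y => (qf N (x + y) - qf N x) * kern N s ρ y) ∧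
    ∫ y, (qf N (x + y) - qf N x) * kern N s ρ y
      ≤ ∫ y, qf N y * (‖y‖ ^ ((N:ℝ) + 2*s))⁻¹ := by
  have hi : Integrable (fun y => (qf N (x + y) - qf N x) * kern N s ρ y) := by
    refine kern_mul_int N hN s hs ρ hρ _ ?_ (1 + qf N x) ?_
    · exact ((qf_cont N).comp (by fun_prop)).sub continuous_const
    · intro y
      have h1 := qf_add_le N x y
      have h2 := qf_nonneg N x
      have h3 := qf_nonneg N y
      have h4 := qf_nonneg N (x+y)
      have h5 : Real.log 2 ≤ 1 := by linarith [Real.log_two_lt_d9]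
      rw [abs_le]
      constructor <;> nlinarith
  refine ⟨hi, ?_⟩
  obtain ⟨hi2, he⟩ := kern_symm N s ρ (fun y => qf N (x + y) - qf N x) hi
  rw [he]
  refine integral_mono hi2 (D_int N hN s hs) (fun y => ?_)
  have hk : kern N s ρ y ≤ (‖y‖ ^ ((N:ℝ) + 2*s))⁻¹ := by
    unfold kern; split_ifs
    · exact le_rfl
    · positivity
  exact mul_le_mul (qf_second N x y) hk (kern_nonneg _ _ _ _) (qf_nonneg N y)

section rot
variable {N : ℕ} (i j : Fin N)

/-- rotation in the coordinate plane `(i,j)` -/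
def rotE (t : ℝ) (y : EN N) : EN N :=
  y + ((Real.cos t - 1) * y i - Real.sin t * y j) • EuclideanSpace.single i (1:ℝ)
    + (Real.sin t * y i + (Real.cos t - 1) * y j) • EuclideanSpace.single j (1:ℝ)

lemma rotE_norm (hij : i ≠ j) (t : ℝ) (y : EN N) : ‖rotE i j t y‖ = ‖y‖ := by
  have h : ∀ a b : ℝ, ‖y + a • EuclideanSpace.single i (1:ℝ) + b • EuclideanSpace.single j (1:ℝ)‖^2
      = ‖y‖^2 + 2 * a * y i + 2 * b * y j + a^2 + b^2 := by
    intro a b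
    rw [norm_add_sq_real, norm_add_sq_real, inner_add_left, inner_smul_right, inner_smul_right,
      inner_smul_right, inner_smul_left, norm_smul, norm_smul, mul_pow, mul_pow]
    simp [EuclideanSpace.inner_single_right, hij.symm]
    ring
  have h2 : ‖rotE i j t y‖^2 = ‖y‖^2 := by
    unfold rotE
    rw [h]
    linear_combination (y i ^ 2 + y j ^ 2) * (Real.sin_sq_add_cos_sq t)
  exact (sq_eq_sq₀ (norm_nonneg _) (norm_nonneg _)).1 h2

def rotL (hij : i ≠ j) (t : ℝ) : EN N →ₗᵢ[ℝ] EN N where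
  toFun := rotE i j t
  map_add' x y := by
    unfold rotE
    simp only [PiLp.add_apply]
    module
  map_smul' c x := by
    unfold rotE
    simp only [PiLp.smul_apply, smul_eq_mul, RingHom.id_apply]
    module
  norm_map' y := rotE_norm i j hij t y

lemma rotE_mp (hij : i ≠ j) (t : ℝ) : MeasurePreserving (rotE i j t) (volume : Measure (EN N)) volume := by
  have := ((rotL i j hij t).toLinearIsometryEquiv rfl).measurePreserving
  exact this

lemma rotE_emb (hij : i ≠ j) (t : ℝ) : MeasurableEmbedding (rotE i j t) := by
  have := ((rotL i j hij t).toLinearIsometryEquiv rfl).toMeasurableEquiv.measurableEmbedding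
  exact this

/-- the logarithmic barrier -/
def Lf (d : ℝ) (x : EN N) : ℝ := Real.log ((x i)^2 + (x j)^2 + d)

lemma Lf_eq (d : ℝ) (x : EN N) : Lf i j d x = Real.log (‖(⟨x i, x j⟩ : ℂ)‖^2 + d) := by
  unfold Lf
  rw [← Complex.normSq_eq_norm_sq, Complex.normSq_mk, sq, sq]

lemma Lf_cont (d : ℝ) (hd : 0 < d) : Continuous (Lf i j d : EN N → ℝ) := by
  unfold Lf
  refine Continuous.log (by fun_prop) (fun x => ?_)
  positivity

lemma rotE_cont : Continuous (fun p : ℝ × EN N => rotE i j p.1 p.2) := by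
  unfold rotE
  fun_prop

lemma Lf_submean (hij : i ≠ j) (d : ℝ) (hd : 0 < d) (x y : EN N) :
    0 ≤ ∫ t in (0:ℝ)..(2 * Real.pi), (Lf i j d (x + rotE i j t y) - Lf i j d x) := by
  have hc : Continuous (fun t : ℝ => Lf i j d (x + rotE i j t y)) :=
    (Lf_cont i j d hd).comp (continuous_const.add ((rotE_cont i j).comp (by fun_prop : Continuous fun t : ℝ => (t, y))))
  rw [intervalIntegral.integral_sub (hc.intervalIntegrable _ _) (by simp)]
  have := submean_complex ⟨x i, x j⟩ ⟨y i, y j⟩ d hd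
  rw [← Lf_eq] at this
  have e : ∀ t : ℝ, Real.log (‖(⟨x i, x j⟩ : ℂ) + Complex.exp (t * Complex.I) * ⟨y i, y j⟩‖^2 + d)
      = Lf i j d (x + rotE i j t y) := by
    intro t
    rw [Lf_eq]
    congr 4
    apply Complex.ext
    · simp [rotE, Complex.exp_ofReal_mul_I_re, Complex.exp_ofReal_mul_I_im, hij]
      ring
    · simp [rotE, Complex.exp_ofReal_mul_I_re, Complex.exp_ofReal_mul_I_im, hij.symm]
      ring
  simp_rw [e] at this
  simp
  linarith

lemma coord_sq_le (hij : i ≠ j) (x : EN N) : (x i)^2 + (x j)^2 ≤ ‖x‖^2 := by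
  rw [EuclideanSpace.real_norm_sq_eq]
  have := Finset.sum_le_sum_of_subset_of_nonneg (s := {i, j}) (t := Finset.univ)
    (f := fun k => (x k)^2) (Finset.subset_univ _) (fun k _ _ => sq_nonneg _)
  rwa [Finset.sum_pair hij] at this

lemma Lf_le (hij : i ≠ j) (d : ℝ) (hd : 0 < d) (hd1 : d ≤ 1) (x : EN N) : Lf i j d x ≤ qf N x := by
  apply Real.log_le_log (by positivity)
  linarith [coord_sq_le i j hij x]

lemma Lf_ge (d : ℝ) (hd : 0 < d) (x : EN N) : Real.log d ≤ Lf i j d x := by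
  apply Real.log_le_log hd
  nlinarith [sq_nonneg (x i), sq_nonneg (x j)]

lemma L_bound (hN : 2 ≤ N) (hij : i ≠ j) (s : ℝ) (hs : s ∈ Ioo (0:ℝ) 1) (ρ : ℝ) (hρ : 0 < ρ)
    (d : ℝ) (hd : 0 < d) (hd1 : d ≤ 1) (x : EN N) :
    Integrable (fun y => (Lf i j d (x + y) - Lf i j d x) * kern N s ρ y) ∧
    0 ≤ ∫ y, (Lf i j d (x + y) - Lf i j d x) * kern N s ρ y := by
  set C : ℝ := 1 + qf N x + |Real.log d| + |Lf i j d x| with hC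
  have hb : ∀ y, |Lf i j d (x + y) - Lf i j d x| ≤ C * (1 + qf N y) := by
    intro y
    have h1 := qf_add_le N x y
    have h2 := qf_nonneg N x
    have h3 := qf_nonneg N y
    have h5 : Real.log 2 ≤ 1 := by linarith [Real.log_two_lt_d9]
    have h6 := Lf_le i j hij d hd hd1 (x + y)
    have h7 := Lf_ge i j d hd (x + y)
    have h8 := neg_abs_le (Real.log d)
    have h9 := neg_abs_le (Lf i j d x)
    have h10 := le_abs_self (Lf i j d x)
    have h11 : C ≤ C * (1 + qf N y) - qf N y := by
      have : 0 ≤ (C - 1) * qf N y := mul_nonneg (by rw [hC]; nlinarith [abs_nonneg (Real.log d), abs_nonneg (Lf i j d x)]) h3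
      nlinarith
    have h12 := abs_nonneg (Real.log d)
    rw [abs_le]
    constructor <;> linarith
  have hcont : Continuous (fun y => Lf i j d (x + y) - Lf i j d x) :=
    ((Lf_cont i j d hd).comp (by fun_prop)).sub continuous_const
  have hi : Integrable (fun y => (Lf i j d (x + y) - Lf i j d x) * kern N s ρ y) :=
    kern_mul_int N hN s hs ρ hρ _ hcont C hb
  refine ⟨hi, ?_⟩
  set W := ∫ y, (Lf i j d (x + y) - Lf i j d x) * kern N s ρ y with hW
  have hrot : ∀ t : ℝ, ∫ y, (Lf i j d (x + rotE i j t y) - Lf i j d x) * kern N s ρ y = W := by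
    intro t
    rw [hW, ← (rotE_mp i j hij t).integral_comp (rotE_emb i j hij t)
      (fun y => (Lf i j d (x + y) - Lf i j d x) * kern N s ρ y)]
    simp_rw [kern_norm (rotE_norm i j hij t _)]
  have hprod : Integrable (Function.uncurry fun (t : ℝ) (y : EN N) =>
      (Lf i j d (x + rotE i j t y) - Lf i j d x) * kern N s ρ y)
      ((volume.restrict (Ioc 0 (2 * Real.pi))).prod volume) := by
    have hdom : Integrable (fun p : ℝ × EN N => C * ((1 + qf N p.2) * kern N s ρ p.2))
        ((volume.restrict (Ioc 0 (2 * Real.pi))).prod volume) :=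
      ((kern_int N hN s hs ρ hρ).const_mul C).comp_snd _
    refine Integrable.mono' hdom ?_ (Eventually.of_forall fun p => ?_)
    · refine Measurable.aestronglyMeasurable ?_
      refine Measurable.mul ?_ ((kern_meas N s ρ).comp measurable_snd)
      exact (((Lf_cont i j d hd).comp (continuous_const.add (rotE_cont i j))).sub continuous_const).measurable
    · simp only [Function.uncurry]
      rw [norm_mul, Real.norm_of_nonneg (kern_nonneg _ _ _ _), ← mul_assoc]
      refine mul_le_mul_of_nonneg_right ?_ (kern_nonneg _ _ _ _)
      have := hb (rotE i j p.1 p.2)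
      have e : qf N (rotE i j p.1 p.2) = qf N p.2 := by unfold qf; rw [rotE_norm i j hij]
      rw [e] at this
      exact this
  have hswap := integral_integral_swap hprod
  simp_rw [hrot] at hswap
  rw [integral_const] at hswap
  have hpos : 0 ≤ ∫ y, ∫ t in Ioc 0 (2 * Real.pi),
      (Lf i j d (x + rotE i j t y) - Lf i j d x) * kern N s ρ y := by
    refine integral_nonneg (fun y => ?_)
    simp only [Pi.zero_apply]
    rw [integral_mul_const, ← intervalIntegral.integral_of_le (by positivity)]
    exact mul_nonneg (Lf_submean i j hij d hd x y) (kern_nonneg _ _ _ _)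
  rw [← hswap] at hpos
  simp [Measure.real, smul_eq_mul] at hpos
  rw [ENNReal.toReal_ofReal Real.pi_pos.le] at hpos
  exact nonneg_of_mul_nonneg_right hpos (by positivity)

end rot

lemma fracLap_rewrite (N : ℕ) (s ε : ℝ) (φ : EN N → ℝ) (x : EN N) :
    ∫ z in {z : EN N | ε ≤ dist x z}, (φ x - φ z) / dist x z ^ ((N:ℝ) + 2*s)
      = ∫ y, (φ x - φ (x + y)) * kern N s ε y := by
  have hm : MeasurableSet {z : EN N | ε ≤ dist x z} :=
    measurableSet_le measurable_const (by fun_prop)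
  rw [← integral_indicator hm, ← integral_add_left_eq_self _ x]
  congr 1
  ext y
  simp only [indicator, mem_ofPred_eq, kern, dist_self_add_right]
  split_ifs
  · rw [div_eq_mul_inv]
  · simp

lemma qf_lower (N : ℕ) (y : EN N) (A B v : ℝ) (hA : 0 ≤ A) (hB : 0 ≤ B)
    (h1 : v ≤ A * ‖y‖^2) (h2 : v ≤ B) : v ≤ (2 * A + 2 * B) * qf N y := by
  have hq := qf_nonneg N y
  have h := Real.one_sub_inv_le_log_of_pos (show 0 < 1 + ‖y‖^2 by positivity)
  have e : 1 - (1 + ‖y‖^2)⁻¹ = ‖y‖^2 / (1 + ‖y‖^2) := by field_simp; ring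
  rw [e] at h
  change _ ≤ qf N y at h
  rcases le_total (‖y‖^2) 1 with hy | hy
  · have : ‖y‖^2 / 2 ≤ qf N y := by
      refine le_trans ?_ h
      gcongr; linarith
    nlinarith [mul_nonneg hB hq]
  · have : 1 / 2 ≤ qf N y := by
      refine le_trans ?_ h
      rw [div_le_div_iff₀ (by norm_num) (by positivity)]; linarith
    nlinarith [mul_nonneg hA hq]

lemma second_diff (N : ℕ) (φ : EN N → ℝ) (hφ : ContDiff ℝ (⊤ : ℕ∞) φ) (hc : HasCompactSupport φ) :
    ∃ C : ℝ, 0 ≤ C ∧ ∀ x y, |((φ x - φ (x + y)) + (φ x - φ (x + -y))) / 2| ≤ C * qf N y := by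
  obtain ⟨B, hB⟩ := hφ.continuous.bounded_above_of_compact_support hc
  have hB0 : 0 ≤ B := (norm_nonneg _).trans (hB 0)
  have hd : ContDiff ℝ 1 (fderiv ℝ φ) := hφ.fderiv_right (by norm_cast)
  have hdc : HasCompactSupport (fderiv ℝ φ) := hc.fderiv ℝ
  obtain ⟨K, hK⟩ := ContDiff.lipschitzWith_of_hasCompactSupport hdc hd (by norm_num)
  have hdiff : Differentiable ℝ φ := hφ.differentiable (by simp)
  refine ⟨2 * (2 * K) + 2 * (2 * B), by positivity, fun x y => ?_⟩
  refine qf_lower N y _ _ _ (by positivity) (by positivity) ?_ ?_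
  · set F : EN N → ℝ := fun w => φ (x + w) + φ (x + -w) with hF
    have hFd : ∀ w, HasFDerivAt F (fderiv ℝ φ (x + w) - fderiv ℝ φ (x + -w)) w := by
      intro w
      have h1 : HasFDerivAt (fun w => φ (x + w)) (fderiv ℝ φ (x + w)) w := by
        have := (hdiff (x + w)).hasFDerivAt.comp w ((hasFDerivAt_id w).const_add x)
        simpa [Function.comp_def] using this
      have h2 : HasFDerivAt (fun w => φ (x + -w)) (-fderiv ℝ φ (x + -w)) w := by
        have := (hdiff (x + -w)).hasFDerivAt.comp w ((hasFDerivAt_id w).neg.const_add x)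
        simpa [Function.comp_def] using this
      rw [sub_eq_add_neg]
      exact h1.add h2
    have hmv := (convex_closedBall (0 : EN N) ‖y‖).norm_image_sub_le_of_norm_hasFDerivWithin_le
      (f := F) (C := 2 * K * ‖y‖) (fun w _ => (hFd w).hasFDerivWithinAt) (fun w hw => ?_)
      (mem_closedBall_self (norm_nonneg y)) (show y ∈ closedBall (0 : EN N) ‖y‖ by simp)
    · have e : ((φ x - φ (x + y)) + (φ x - φ (x + -y))) / 2 = - (F y - F 0) / 2 := by
        simp only [hF, add_zero, neg_zero]; ring
      rw [e, abs_div, abs_neg, abs_two]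
      rw [Real.norm_eq_abs, sub_zero] at hmv
      have := abs_nonneg (F y - F 0)
      have : 0 ≤ (K:ℝ) := K.2
      nlinarith [norm_nonneg y]
    · have := hK.dist_le_mul (x + w) (x + -w)
      rw [dist_eq_norm, dist_eq_norm] at this
      refine this.trans ?_
      have e : x + w - (x + -w) = (2:ℝ) • w := by rw [two_smul]; abel
      rw [e, norm_smul]
      simp only [mem_closedBall, dist_zero_right] at hw
      have : 0 ≤ (K:ℝ) := K.2
      norm_num
      nlinarith
  · have h1 := hB x
    have h2 := hB (x + y)
    have h3 := hB (x + -y)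
    rw [Real.norm_eq_abs, abs_le] at h1 h2 h3
    rw [abs_le]
    constructor <;> linarith [h1.1, h1.2, h2.1, h2.2, h3.1, h3.2]

lemma diff_int (N : ℕ) (hN : 2 ≤ N) (s : ℝ) (hs : s ∈ Ioo (0:ℝ) 1) (ρ : ℝ) (hρ : 0 < ρ)
    (φ : EN N → ℝ) (hφ : Continuous φ) (hc : HasCompactSupport φ) (x : EN N) :
    Integrable (fun y => (φ x - φ (x + y)) * kern N s ρ y) := by
  obtain ⟨B, hB⟩ := hφ.bounded_above_of_compact_support hc
  have hB0 : 0 ≤ B := (norm_nonneg _).trans (hB 0)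
  refine kern_mul_int N hN s hs ρ hρ _ (by fun_prop) (2 * B) (fun y => ?_)
  have h1 := hB x
  have h2 := hB (x + y)
  have := qf_nonneg N y
  have h3 : |φ x - φ (x + y)| ≤ 2 * B := (abs_sub _ _).trans (by
    rw [Real.norm_eq_abs] at h1 h2; linarith)
  nlinarith

lemma hasFracLap_exists (N : ℕ) (hN : 2 ≤ N) (s : ℝ) (hs : s ∈ Ioo (0:ℝ) 1)
    (φ : EN N → ℝ) (hφ : ContDiff ℝ (⊤ : ℕ∞) φ) (hc : HasCompactSupport φ) (x : EN N) :
    ∃ L, HasFracLap N s φ x L := by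
  obtain ⟨C, hC0, hC⟩ := second_diff N φ hφ hc
  set F : EN N → ℝ := fun y => ((φ x - φ (x + y)) + (φ x - φ (x + -y))) / 2 with hF
  refine ⟨CNs N s * ∫ y, F y * (‖y‖ ^ ((N:ℝ) + 2*s))⁻¹, ?_⟩
  unfold HasFracLap
  refine Tendsto.const_mul _ ?_
  have h1 : ∀ᶠ ε in 𝓝[>] (0:ℝ), ∫ y, F y * kern N s ε y =
      ∫ z in {z : EN N | ε ≤ dist x z}, (φ x - φ z) / dist x z ^ ((N:ℝ) + 2*s) := by
    filter_upwards [self_mem_nhdsWithin] with ε hε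
    rw [fracLap_rewrite, (kern_symm N s ε (fun y => φ x - φ (x + y))
      (diff_int N hN s hs ε hε φ hφ.continuous hc x)).2]
  refine Tendsto.congr' h1 ?_
  have hcF : Continuous F := by
    have := hφ.continuous
    fun_prop
  refine tendsto_integral_filter_of_dominated_convergence
    (fun y => C * (qf N y * (‖y‖ ^ ((N:ℝ) + 2*s))⁻¹)) ?_ ?_ ((D_int N hN s hs).const_mul C) ?_
  · exact Eventually.of_forall fun ε => (hcF.measurable.mul (kern_meas N s ε)).aestronglyMeasurable
  · refine Eventually.of_forall fun ε => Eventually.of_forall fun y => ?_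
    rw [norm_mul, Real.norm_of_nonneg (kern_nonneg _ _ _ _), ← mul_assoc]
    refine mul_le_mul (hC x y) ?_ (kern_nonneg _ _ _ _) (mul_nonneg hC0 (qf_nonneg N y))
    unfold kern; split_ifs
    · exact le_rfl
    · positivity
  · refine Eventually.of_forall fun y => ?_
    rcases eq_or_ne y 0 with rfl | hy
    · simp [hF]
    · refine tendsto_const_nhds.congr' ?_
      have : Iio ‖y‖ ∈ 𝓝[>] (0:ℝ) := mem_nhdsWithin_of_mem_nhds (Iio_mem_nhds (norm_pos_iff.2 hy))
      filter_upwards [this] with ε hε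
      simp [kern, le_of_lt (mem_Iio.1 hε)]

lemma CNs_pos (N : ℕ) (s : ℝ) (hs : s ∈ Ioo (0:ℝ) 1) : 0 < CNs N s := by
  unfold CNs
  have h1 : 0 < Real.Gamma ((N + 2*s)/2) := Real.Gamma_pos_of_pos (by
    have := hs.1; positivity)
  have h2 : 0 < Real.Gamma (1 - s) := Real.Gamma_pos_of_pos (by linarith [hs.2])
  have := hs.1
  have := Real.pi_pos
  positivity

section test
variable {N : ℕ} (i j : Fin N)

def psiF (M : ℝ) (n : ℕ) (x : EN N) : ℝ :=
  1/2 + (1/((n:ℝ)+1)) * Lf i j (Real.exp (-2 * ((n:ℝ)+1))) x - M * qf N x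

def phiF (M : ℝ) (n : ℕ) (x : EN N) : ℝ := expNegInvGlue (psiF i j M n x)

lemma dn_le (n : ℕ) : Real.exp (-2 * ((n:ℝ)+1)) ≤ 1 := by
  rw [Real.exp_le_one_iff]
  have : (0:ℝ) ≤ n := Nat.cast_nonneg n
  linarith

lemma psiF_le (hij : i ≠ j) (M : ℝ) (n : ℕ) (x : EN N) :
    psiF i j M n x ≤ 1/2 - (M - 1) * qf N x := by
  unfold psiF
  have h1 := Lf_le i j hij _ (Real.exp_pos _) (dn_le n) x
  have hq := qf_nonneg N x
  have hn : (0:ℝ) ≤ n := Nat.cast_nonneg n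
  have h2 : 1/((n:ℝ)+1) * Lf i j (Real.exp (-2 * ((n:ℝ)+1))) x ≤ 1 * qf N x := by
    refine (mul_le_mul_of_nonneg_left h1 (by positivity)).trans ?_
    refine mul_le_mul_of_nonneg_right ?_ hq
    rw [div_le_one (by positivity)]; linarith
  linarith

lemma psiF_contDiff (M : ℝ) (n : ℕ) : ContDiff ℝ (⊤ : ℕ∞) (psiF i j M n : EN N → ℝ) := by
  unfold psiF Lf qf
  refine ((contDiff_const).add (contDiff_const.mul (ContDiff.log ?_ ?_))).sub
    (contDiff_const.mul (ContDiff.log ?_ ?_))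
  · fun_prop
  · intro x; positivity
  · exact contDiff_const.add (contDiff_norm_sq ℝ)
  · intro x; positivity

lemma phiF_contDiff (M : ℝ) (n : ℕ) : ContDiff ℝ (⊤ : ℕ∞) (phiF i j M n : EN N → ℝ) := by
  unfold phiF
  exact expNegInvGlue.contDiff.comp (psiF_contDiff i j M n)

lemma phiF_nonneg (M : ℝ) (n : ℕ) (x : EN N) : 0 ≤ phiF i j M n x := expNegInvGlue.nonneg _

lemma phiF_tsupport (hij : i ≠ j) (M r : ℝ) (hr : 0 < r) (hM : 1/2 ≤ (M - 1) * Real.log (1 + r^2))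
    (hM1 : 1 ≤ M) (n : ℕ) : tsupport (phiF i j M n : EN N → ℝ) ⊆ closedBall 0 r \ {0} := by
  intro x hx
  constructor
  · refine closure_minimal ?_ isClosed_closedBall hx
    intro y hy
    by_contra hyr
    simp only [mem_closedBall, dist_zero_right, not_le] at hyr
    apply hy
    refine expNegInvGlue.zero_of_nonpos ((psiF_le i j hij M n y).trans ?_)
    have : Real.log (1 + r^2) ≤ qf N y := Real.log_le_log (by positivity) (by gcongr)
    nlinarith
  · rintro rfl
    rw [← notMem_compl_iff] at hx
    apply hx
    rw [mem_compl_iff, notMem_tsupport_iff_eventuallyEq]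
    have h0 : psiF i j M n (0 : EN N) < 0 := by
      have : (n:ℝ) + 1 ≠ 0 := by positivity
      simp only [psiF, Lf, qf, PiLp.zero_apply, norm_zero]
      norm_num
      field_simp
      norm_num
    have := ((psiF_contDiff i j M n).continuous.tendsto (0 : EN N)).eventually (Iio_mem_nhds h0)
    filter_upwards [this] with y hy
    exact expNegInvGlue.zero_of_nonpos (le_of_lt hy)

lemma fracLap_le (hN : 2 ≤ N) (hij : i ≠ j) (s : ℝ) (hs : s ∈ Ioo (0:ℝ) 1) (M r : ℝ) (hr : 0 < r)
    (hM : 1/2 ≤ (M - 1) * Real.log (1 + r^2))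
    (hM1 : 1 ≤ M) (n : ℕ) (x : EN N) (L : ℝ) (hL : HasFracLap N s (phiF i j M n) x L) :
    L ≤ CNs N s * (2 * (M * ∫ y : EN N, qf N y * (‖y‖ ^ ((N:ℝ) + 2*s))⁻¹)) := by
  have hcs : HasCompactSupport (phiF i j M n : EN N → ℝ) :=
    (isCompact_closedBall (0:EN N) r).of_isClosed_subset (isClosed_tsupport _)
      ((phiF_tsupport i j hij M r hr hM hM1 n).trans sdiff_subset)
  refine le_of_tendsto hL ?_
  filter_upwards [self_mem_nhdsWithin] with ε hε
  have hε0 : 0 < ε := hε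
  refine mul_le_mul_of_nonneg_left ?_ (CNs_pos N s hs).le
  rw [fracLap_rewrite]
  have hp : ∀ y, psiF i j M n y ≤ 1/2 := by
    intro y
    have := psiF_le i j hij M n y
    have := qf_nonneg N y
    nlinarith
  obtain ⟨c, hc0, hc2, hc⟩ := h_tangent (psiF i j M n x) (hp x)
  set d := Real.exp (-2 * ((n:ℝ)+1)) with hd
  obtain ⟨hLi, hLb⟩ := L_bound i j hN hij s hs ε hε0 d (Real.exp_pos _) (dn_le n) x
  obtain ⟨hqi, hqb⟩ := q_bound N hN s hs ε hε0 x
  set Dd := ∫ y : EN N, qf N y * (‖y‖ ^ ((N:ℝ) + 2*s))⁻¹ with hDd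
  have hD0 : 0 ≤ Dd := integral_nonneg fun y => mul_nonneg (qf_nonneg N y) (by positivity)
  set a : ℝ := 1/((n:ℝ)+1) with ha
  have ha0 : 0 ≤ a := by positivity
  calc ∫ y, (phiF i j M n x - phiF i j M n (x + y)) * kern N s ε y
      ≤ ∫ y, (c * M * ((qf N (x + y) - qf N x) * kern N s ε y)
        - c * a * ((Lf i j d (x + y) - Lf i j d x) * kern N s ε y)) := by
        refine integral_mono (diff_int N hN s hs ε hε0 _ (phiF_contDiff i j M n).continuous hcs x)
          ((hqi.const_mul _).sub (hLi.const_mul _)) (fun y => ?_)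
        have h1 := mul_le_mul_of_nonneg_right (hc (psiF i j M n (x + y)) (hp _)) (kern_nonneg N s ε y)
        refine h1.trans (le_of_eq ?_)
        simp only [psiF, ← hd, ← ha]
        ring
    _ = c * M * (∫ y, (qf N (x + y) - qf N x) * kern N s ε y)
        - c * a * ∫ y, (Lf i j d (x + y) - Lf i j d x) * kern N s ε y := by
        rw [integral_sub (hqi.const_mul _) (hLi.const_mul _), integral_const_mul, integral_const_mul]
    _ ≤ c * M * Dd - 0 := by
        have := mul_nonneg (mul_nonneg hc0 ha0) hLb
        have := mul_le_mul_of_nonneg_left hqb (mul_nonneg hc0 (by linarith : 0 ≤ M))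
        linarith
    _ ≤ 2 * (M * Dd) := by
        have : 0 ≤ M * Dd := by positivity
        nlinarith

end test

lemma u_int (N : ℕ) (s : ℝ) (hs : s ∈ Ioo (0:ℝ) 1) (Ω : Set (EN N)) (hb : Bornology.IsBounded Ω)
    (hm : MeasurableSet Ω)
    (u : EN N → ℝ) (hw : MemL1w N s u) (hz : ∀ x ∉ Ω, u x = 0) : Integrable u := by
  obtain ⟨R, hR0, hR⟩ := hb.exists_pos_norm_le
  have hp : (0:ℝ) < (N:ℝ) + 2*s := by have := hs.1; positivity
  have h := Integrable.bdd_mul (c := 1 + R ^ ((N:ℝ) + 2*s)) hw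
    (f := Ω.indicator (fun x => 1 + ‖x‖ ^ ((N:ℝ) + 2*s))) ?_ ?_
  · refine h.congr (Eventually.of_forall fun x => ?_)
    by_cases hx : x ∈ Ω
    · simp only [indicator_of_mem hx]
      have : 1 + ‖x‖ ^ ((N:ℝ) + 2*s) ≠ 0 := by positivity
      field_simp
    · simp [indicator_of_notMem hx, hz x hx]
  · refine (Measurable.indicator ?_ hm).aestronglyMeasurable
    fun_prop
  · refine Eventually.of_forall fun x => ?_
    by_cases hx : x ∈ Ω
    · have hxR := hR x hx
      simp only [indicator_of_mem hx]
      rw [Real.norm_of_nonneg (by positivity)]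
      gcongr
    · simp only [indicator_of_notMem hx, norm_zero]
      positivity

lemma holder_contOn (N : ℕ) (θ : ℝ) (hθ : 0 < θ) (f : EN N → ℝ) (S K : Set (EN N))
    (hf : HolderLocOn N θ f S) (hKS : K ⊆ S) (hK : IsCompact K) : ContinuousOn f K := by
  obtain ⟨C, hC⟩ := hf K hKS hK
  intro x hx
  rw [ContinuousWithinAt, tendsto_iff_dist_tendsto_zero]
  have h : Tendsto (fun y => C * dist y x ^ θ) (𝓝[K] x) (𝓝 0) := by
    have h1 : Tendsto (fun y => dist y x) (𝓝[K] x) (𝓝 0) := by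
      have : Tendsto (fun y => dist y x) (𝓝 x) (𝓝 (dist x x)) := (by fun_prop : Continuous fun y => dist y x).tendsto x
      rw [dist_self] at this
      exact this.mono_left nhdsWithin_le_nhds
    have h2 := (h1.rpow_const (Or.inr hθ.le)).const_mul C
    rwa [Real.zero_rpow hθ.ne', mul_zero] at h2
  refine squeeze_zero' (Eventually.of_forall fun y => dist_nonneg) ?_ h
  filter_upwards [self_mem_nhdsWithin] with y hy
  rw [Real.dist_eq]
  exact hC y hy x hx

lemma psiF_tendsto {N : ℕ} (i j : Fin N) (M : ℝ) (x : EN N) (hx : x i ≠ 0) :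
    Tendsto (fun n : ℕ => psiF i j M n x) atTop (𝓝 (1/2 - M * qf N x)) := by
  unfold psiF Lf
  refine Tendsto.sub_const ?_ _
  have h1 : Tendsto (fun n : ℕ => 1 / ((n:ℝ) + 1)) atTop (𝓝 0) := tendsto_one_div_add_atTop_nhds_zero_nat
  have h2 : Tendsto (fun n : ℕ => Real.exp (-2 * ((n:ℝ) + 1))) atTop (𝓝 0) := by
    refine Real.tendsto_exp_atBot.comp ?_
    refine Tendsto.const_mul_atTop_of_neg (by norm_num) ?_
    exact tendsto_atTop_add_const_right _ _ tendsto_natCast_atTop_atTop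
  have h3 := ((h2.const_add ((x i)^2 + (x j)^2)).log (by positivity))
  have h4 := (h1.mul h3).const_add (1/2)
  simpa using h4

lemma ae_coord {N : ℕ} (i : Fin N) : ∀ᵐ x : EN N, x i ≠ 0 := by
  set P : Submodule ℝ (EN N) := LinearMap.ker (EuclideanSpace.proj i : EN N →L[ℝ] ℝ).toLinearMap with hP
  have hne : P ≠ ⊤ := by
    intro h
    have : (EuclideanSpace.single i (1:ℝ) : EN N) ∈ P := by rw [h]; trivial
    rw [hP, LinearMap.mem_ker] at this
    simp at this
  have h0 := Measure.addHaar_submodule (volume : Measure (EN N)) P hne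
  rw [ae_iff]
  refine measure_mono_null ?_ h0
  intro x hx
  simp only [ne_eq, not_not] at hx
  change x ∈ P
  rw [hP, LinearMap.mem_ker]
  simpa using hx

/-- Theorem 1.1(ii) (`μ = 0` case): nonexistence of nonnegative singular
solutions when `f ≥ 0` is not integrable on `Ω`. -/
theorem nonexistence_fractional_laplacian_non_integrable
    (N : ℕ) (hN : 2 ≤ N) (s : ℝ) (hs : s ∈ Ioo (0:ℝ) 1)
    (Ω : Set (EN N)) (hΩ : IsBoundedC2Domain N Ω) (h0 : (0:EN N) ∈ Ω)
    (θ : ℝ) (hθ : θ ∈ Ioo (0:ℝ) 1)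
    (f : EN N → ℝ) (hf : HolderLocOn N θ f (closure Ω \ {0}))
    (hfpos : ∀ x ∈ Ω, 0 ≤ f x)
    (hfinf : ∫⁻ x in Ω, ENNReal.ofReal (f x) = ⊤) :
    ¬ ∃ u : EN N → ℝ, (∀ x, 0 ≤ u x) ∧ IsDistrSol N s 0 Ω f u := by
  rintro ⟨u, hu0, hloc, hw, hz, heq⟩
  have hopen := hΩ.isOpen
  have hui : Integrable u := u_int N s hs Ω hΩ.isBounded hopen.measurableSet u hw hz
  -- coordinates and radii
  set i : Fin N := ⟨0, by omega⟩ with hi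
  set j : Fin N := ⟨1, by omega⟩ with hj
  have hij : i ≠ j := by rw [hi, hj]; simp
  obtain ⟨r, hr, hrΩ⟩ := Metric.nhds_basis_closedBall.mem_iff.1 (hopen.mem_nhds h0)
  have hl : 0 < Real.log (1 + r^2) := Real.log_pos (by nlinarith)
  obtain ⟨M, hM1, hM⟩ : ∃ M : ℝ, 1 ≤ M ∧ 1/2 ≤ (M - 1) * Real.log (1 + r^2) := by
    refine ⟨1 + (1/2) / Real.log (1 + r^2), ?_, ?_⟩
    · have : 0 ≤ (1/2) / Real.log (1 + r^2) := by positivity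
      linarith
    · rw [add_sub_cancel_left, div_mul_cancel₀ _ hl.ne']
  have hq0 : ∀ᶠ x : EN N in 𝓝 0, M * qf N x < 1/4 := by
    have : Continuous (fun x => M * qf N x) := continuous_const.mul (qf_cont N)
    have h := this.tendsto (0 : EN N)
    refine h.eventually (Iio_mem_nhds ?_)
    simp [qf]
  obtain ⟨δ, hδ, hδq⟩ := Metric.eventually_nhds_iff_ball.1 hq0
  set r0 := min δ r with hr0d
  have hr0 : 0 < r0 := lt_min hδ hr
  have hballΩ : ball (0:EN N) r0 ⊆ Ω := fun x hx => hrΩ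
    (ball_subset_closedBall (ball_subset_ball (min_le_right _ _) hx))
  -- test functions
  set Dd := ∫ y : EN N, qf N y * (‖y‖ ^ ((N:ℝ) + 2*s))⁻¹ with hDd
  set C0 := CNs N s * (2 * (M * Dd)) with hC0
  have hts : ∀ n : ℕ, tsupport (phiF i j M n : EN N → ℝ) ⊆ Ω \ {0} := fun n =>
    (phiF_tsupport i j hij M r hr hM hM1 n).trans (sdiff_subset_sdiff_left hrΩ)
  have hcs : ∀ n : ℕ, HasCompactSupport (phiF i j M n : EN N → ℝ) := fun n =>
    (isCompact_closedBall (0:EN N) r).of_isClosed_subset (isClosed_tsupport _)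
      ((phiF_tsupport i j hij M r hr hM hM1 n).trans sdiff_subset)
  have hint : ∀ n : ℕ, Integrable (fun x => f x * phiF i j M n x) := by
    intro n
    have hcf : ContinuousOn f (tsupport (phiF i j M n : EN N → ℝ)) :=
      holder_contOn N θ hθ.1 f _ _ hf ((hts n).trans (sdiff_subset_sdiff_left subset_closure)) (hcs n)
    have h1 : IntegrableOn (fun x => f x * phiF i j M n x) (tsupport (phiF i j M n : EN N → ℝ)) :=
      (hcf.mul (phiF_contDiff i j M n).continuous.continuousOn).integrableOn_compact (hcs n)
    refine (integrableOn_iff_integrable_of_support_subset ?_).1 h1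
    intro x hx
    apply subset_tsupport
    intro h
    apply hx
    simp [h]
  have hbound : ∀ n : ℕ, ∫ x in Ω, f x * phiF i j M n x ≤ C0 * ∫ x, u x := by
    intro n
    choose g hg using fun x => hasFracLap_exists N hN s hs (phiF i j M n)
      (phiF_contDiff i j M n) (hcs n) x
    have h1 := heq (phiF i j M n) (phiF_contDiff i j M n) (hcs n) (hts n) g hg
    rw [zero_mul, add_zero] at h1
    rw [← h1, ← integral_const_mul]
    have hgle : ∀ x, u x * g x ≤ C0 * u x := by
      intro x
      have := fracLap_le i j hN hij s hs M r hr hM hM1 n x (g x) (hg x)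
      rw [mul_comm]
      exact mul_le_mul_of_nonneg_right this (hu0 x)
    by_cases hug : Integrable (fun x => u x * g x)
    · exact integral_mono hug (hui.const_mul _) hgle
    · rw [integral_undef hug]
      refine integral_nonneg fun x => mul_nonneg ?_ (hu0 x)
      have hD0 : 0 ≤ Dd := integral_nonneg fun y => mul_nonneg (qf_nonneg N y) (by positivity)
      have := CNs_pos N s hs
      positivity
  have hlb : ∀ n : ℕ, ∫⁻ x in ball (0:EN N) r0, ENNReal.ofReal (f x * phiF i j M n x)
      ≤ ENNReal.ofReal (C0 * ∫ x, u x) := by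
    intro n
    calc _ ≤ ∫⁻ x in Ω, ENNReal.ofReal (f x * phiF i j M n x) := lintegral_mono_set hballΩ
      _ = ENNReal.ofReal (∫ x in Ω, f x * phiF i j M n x) := by
        rw [ofReal_integral_eq_lintegral_ofReal (hint n).integrableOn]
        refine (ae_restrict_iff' hopen.measurableSet).2 (Eventually.of_forall fun x hx => ?_)
        exact mul_nonneg (hfpos x hx) (phiF_nonneg i j M n x)
      _ ≤ _ := ENNReal.ofReal_le_ofReal (hbound n)
  set c := expNegInvGlue (1/4) with hc
  have hc0 : 0 < c := expNegInvGlue.pos_of_pos (by norm_num)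
  have hball : ∫⁻ x in ball (0:EN N) r0, ENNReal.ofReal (f x) * ENNReal.ofReal c
      ≤ ENNReal.ofReal (C0 * ∫ x, u x) := by
    calc _ ≤ ∫⁻ x in ball (0:EN N) r0,
          liminf (fun n : ℕ => ENNReal.ofReal (f x * phiF i j M n x)) atTop := by
          refine lintegral_mono_ae ?_
          filter_upwards [ae_restrict_mem measurableSet_ball, ae_restrict_of_ae (ae_coord i)] with x hx hxi
          have hfx := hfpos x (hballΩ hx)
          have hp : ∀ᶠ n : ℕ in atTop, 1/4 < psiF i j M n x := by
            refine (psiF_tendsto i j M x hxi).eventually (Ioi_mem_nhds ?_)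
            have := hδq x (ball_subset_ball (min_le_left _ _) hx)
            linarith
          refine le_liminf_of_le (by isBoundedDefault) ?_
          filter_upwards [hp] with n hn
          rw [← ENNReal.ofReal_mul hfx]
          refine ENNReal.ofReal_le_ofReal (mul_le_mul_of_nonneg_left ?_ hfx)
          exact expNegInvGlue.monotone hn.le
      _ ≤ liminf (fun n : ℕ => ∫⁻ x in ball (0:EN N) r0, ENNReal.ofReal (f x * phiF i j M n x)) atTop :=
          lintegral_liminf_le' fun n => (hint n).aestronglyMeasurable.aemeasurable.ennreal_ofReal.restrict
      _ ≤ _ := by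
          refine (liminf_le_liminf (Eventually.of_forall hlb)).trans ?_
          simp
  have hball2 : ∫⁻ x in ball (0:EN N) r0, ENNReal.ofReal (f x) < ⊤ := by
    rw [lintegral_mul_const' _ _ ENNReal.ofReal_ne_top] at hball
    by_contra h
    rw [not_lt, top_le_iff] at h
    rw [h, ENNReal.top_mul (by simpa using hc0)] at hball
    exact absurd (top_le_iff.1 hball) ENNReal.ofReal_ne_top
  -- away from the origin
  set K := closure Ω \ ball (0:EN N) r0 with hK
  have hKc : IsCompact K := (hΩ.isBounded.isCompact_closure).diff isOpen_ball
  have hKs : K ⊆ closure Ω \ {0} := by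
    rintro x ⟨h1, h2⟩
    refine ⟨h1, ?_⟩
    rintro rfl
    exact h2 (mem_ball_self hr0)
  obtain ⟨B, hB⟩ := hKc.exists_bound_of_continuousOn (holder_contOn N θ hθ.1 f _ K hf hKs hKc)
  have hKint : ∫⁻ x in K, ENNReal.ofReal (f x) < ⊤ := by
    refine lt_of_le_of_lt (setLIntegral_mono' hKc.measurableSet
      (fun x hx => ENNReal.ofReal_le_ofReal ((le_abs_self _).trans (hB x hx)))) ?_
    rw [setLIntegral_const]
    exact ENNReal.mul_lt_top ENNReal.ofReal_lt_top hKc.measure_lt_top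
  have hcov : Ω ⊆ ball (0:EN N) r0 ∪ K := by
    intro x hx
    by_cases h : x ∈ ball (0:EN N) r0
    · exact Or.inl h
    · exact Or.inr ⟨subset_closure hx, h⟩
  have : ∫⁻ x in Ω, ENNReal.ofReal (f x) < ⊤ :=
    lt_of_le_of_lt ((lintegral_mono_set hcov).trans (lintegral_union_le _ _ _))
      (ENNReal.add_lt_top.2 ⟨hball2, hKint⟩)
  exact this.ne hfinf
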